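/- Let n ≥ 1, κ > 0, let L₁,…,Lₙ > 0, S > 0, t > 0, P > 0, and let 0 < pᵢ ≤ P for i = 1,…,n. Let μ be the product on ℝⁿ of n copies of the Gamma distribution with shape κ and rate κ. Then μ{λ ∈ ℝⁿ : ∑_{i=1}^n Lᵢ·log₂(1 + S·λᵢ·pᵢ) < t} ≤ (∏_{i=1}^n (P/pᵢ)^κ) · μ{λ ∈ ℝⁿ : ∑_{i=1}^n Lᵢ·log₂(1 + S·λᵢ·P) < t}. -/

import Mathlib

open MeasureTheory ProbabilityTheory Real

lemma gammaPDF_le_mul_gammaPDF_mul {a r c : ℝ} (ha : 0 < a) (hr : 0 < r) (hc : 0 < c)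
    (hc1 : c ≤ 1) (x : ℝ) :
    gammaPDF a r x ≤ ENNReal.ofReal (c ^ (1 - a)) * gammaPDF a r (c * x) := by
  rcases lt_or_ge x 0 with hx | hx
  · simp [gammaPDF_of_neg hx]
  rw [gammaPDF_of_nonneg hx, gammaPDF_of_nonneg (mul_nonneg hc.le hx),
    ← ENNReal.ofReal_mul (by positivity), Real.mul_rpow hc.le hx]
  apply ENNReal.ofReal_le_ofReal
  have h1 : c ^ (1 - a) * c ^ (a - 1) = 1 := by
    rw [← Real.rpow_add hc]
    simp
  have hΓ := Real.Gamma_pos_of_pos ha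
  calc r ^ a / Real.Gamma a * x ^ (a - 1) * Real.exp (-(r * x))
      ≤ r ^ a / Real.Gamma a * x ^ (a - 1) * Real.exp (-(r * (c * x))) := by
        gcongr
        exact mul_le_of_le_one_left hx hc1
    _ = c ^ (1 - a) * c ^ (a - 1) *
          (r ^ a / Real.Gamma a * x ^ (a - 1) * Real.exp (-(r * (c * x)))) := by
        rw [h1, one_mul]
    _ = _ := by ring

lemma map_mul_left_gammaMeasure_le {a r c : ℝ} (ha : 0 < a) (hr : 0 < r) (hc : 0 < c)
    (hc1 : c ≤ 1) :
    (gammaMeasure a r).map (c * ·) ≤ ENNReal.ofReal (c ^ (-a)) • gammaMeasure a r := by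
  have hm : Measurable (c * · : ℝ → ℝ) := measurable_const_mul c
  have hpdf : Measurable (gammaPDF a r) := (measurable_gammaPDFReal a r).ennreal_ofReal
  refine Measure.le_iff.2 fun s hs => ?_
  rw [Measure.map_apply hm hs, Measure.smul_apply, smul_eq_mul, gammaMeasure,
    withDensity_apply _ (hm hs), withDensity_apply _ hs]
  calc ∫⁻ x in (c * ·) ⁻¹' s, gammaPDF a r x
      ≤ ∫⁻ x in (c * ·) ⁻¹' s, ENNReal.ofReal (c ^ (1 - a)) * gammaPDF a r (c * x) :=
        lintegral_mono fun x => gammaPDF_le_mul_gammaPDF_mul ha hr hc hc1 x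
    _ = ENNReal.ofReal (c ^ (1 - a)) * ∫⁻ y in s, gammaPDF a r y ∂(volume.map (c * ·)) := by
        rw [lintegral_const_mul' _ _ ENNReal.ofReal_ne_top, setLIntegral_map hs hpdf hm]
    _ = ENNReal.ofReal (c ^ (-a)) * ∫⁻ y in s, gammaPDF a r y := by
        rw [Real.map_volume_mul_left hc.ne', Measure.restrict_smul, lintegral_smul_measure,
          smul_eq_mul, ← mul_assoc, ← ENNReal.ofReal_mul (by positivity),
          abs_of_pos (inv_pos.2 hc), ← Real.rpow_neg_one c, ← Real.rpow_add hc]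
        congr 3
        ring_nf

lemma MeasureTheory.Measure.pi_mono {ι : Type*} [Fintype ι] {α : ι → Type*}
    [∀ i, MeasurableSpace (α i)] {μ ν : ∀ i, Measure (α i)} (h : ∀ i, μ i ≤ ν i) :
    Measure.pi μ ≤ Measure.pi ν := by
  refine Measure.le_iff.2 fun s hs => ?_
  rw [Measure.pi, Measure.pi, toMeasure_apply _ _ hs, toMeasure_apply _ _ hs]
  refine OuterMeasure.le_pi.2 (fun t _ => (OuterMeasure.pi_pi_le _ t).trans ?_) s
  exact Finset.prod_le_prod' fun i _ => h i (t i)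

lemma MeasureTheory.Measure.pi_nnreal_smul {ι : Type*} [Fintype ι] {α : ι → Type*}
    [∀ i, MeasurableSpace (α i)] (μ : ∀ i, Measure (α i)) [∀ i, IsFiniteMeasure (μ i)]
    (c : ι → NNReal) :
    Measure.pi (fun i => c i • μ i) = (∏ i, c i) • Measure.pi μ := by
  refine Measure.pi_eq fun s _ => ?_
  simp only [Measure.smul_apply, ENNReal.smul_def, smul_eq_mul, Measure.pi_pi,
    Finset.prod_mul_distrib, ENNReal.ofNNReal_finsetProd]

theorem outage_bound_nakagami
    (n : ℕ) (hn : 1 ≤ n) (κ : ℝ) (hκ : 0 < κ)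
    (L : Fin n → ℝ) (hL : ∀ i, 0 < L i)
    (S t P : ℝ) (hS : 0 < S) (ht : 0 < t) (hP : 0 < P)
    (p : Fin n → ℝ) (hp : ∀ i, 0 < p i) (hpP : ∀ i, p i ≤ P)
    (μ : Measure (Fin n → ℝ))
    (hμ : μ = Measure.pi fun _ : Fin n => gammaMeasure κ κ) :
    μ {lam : Fin n → ℝ | ∑ i, L i * Real.logb 2 (1 + S * lam i * p i) < t}
      ≤ ENNReal.ofReal (∏ i, (P / p i) ^ κ) *
        μ {lam : Fin n → ℝ | ∑ i, L i * Real.logb 2 (1 + S * lam i * P) < t} := by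
  subst hμ
  have := isProbabilityMeasure_gammaMeasure hκ hκ
  have hm : ∀ i, Measurable (p i / P * · : ℝ → ℝ) := fun i => measurable_const_mul _
  have hle : (Measure.pi fun _ : Fin n => gammaMeasure κ κ).map (fun x i => p i / P * x i) ≤
      ENNReal.ofReal (∏ i, (P / p i) ^ κ) • Measure.pi fun _ : Fin n => gammaMeasure κ κ := by
    have hfin : ∀ i, IsProbabilityMeasure ((gammaMeasure κ κ).map (p i / P * ·)) :=
      fun i => Measure.isProbabilityMeasure_map (hm i).aemeasurable
    rw [Measure.pi_map_pi fun i => (hm i).aemeasurable]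
    refine (Measure.pi_mono (ν := fun i => ((P / p i) ^ κ).toNNReal • gammaMeasure κ κ)
      fun i => ?_).trans_eq ?_
    · have h := map_mul_left_gammaMeasure_le hκ hκ (div_pos (hp i) hP)
        ((div_le_one hP).2 (hpP i))
      rwa [Real.rpow_neg (div_pos (hp i) hP).le, ← Real.inv_rpow (div_pos (hp i) hP).le,
        inv_div] at h
    · rw [Measure.pi_nnreal_smul, ← Real.toNNReal_prod_of_nonneg
        fun i _ => Real.rpow_nonneg (div_pos hP (hp i)).le κ]
      rfl
  refine le_trans ?_ (hle _)
  refine le_trans (measure_mono fun x hx => ?_)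
    (Measure.le_map_apply (measurable_pi_lambda _ fun i =>
      (hm i).comp (measurable_pi_apply i)).aemeasurable _)
  have h : ∀ i, S * (p i / P * x i) * P = S * x i * p i := fun i => by field_simp
  simpa [h] using hx
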